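/- Let h : E → ℝ ∪ {+∞} be proper closed convex, let f₁, f₂ : E → ℝ be continuously differentiable, and suppose f₂(u) − f₂(w) − ⟨∇f₂(w), u − w⟩ ≤ (M₂⁺/2)‖u − w‖² for some M₂⁺ ≥ 0 and every u, w ∈ dom h. Let λ > 0, θ ∈ (0,1], ε ≥ 0, x₀ ∈ E, y ∈ dom h, and v ∈ E. Set M := λM₂⁺ + 1, ψ_s(u) := λ[f₁(x₀) + ⟨∇f₁(x₀), u − x₀⟩ + f₂(u)] + (1/2)‖u − x₀‖², and ψ := ψ_s + λh. Define ŷ := argmin_{u ∈ E} { ⟨∇ψ_s(y) − v, u⟩ + (M/2)‖u − y‖² + λh(u) }, v_r := v + M(y − ŷ) + ∇ψ_s(ŷ) − ∇ψ_s(y), v̂ := (1/λ)(v_r + x₀ − y) + ∇f₁(ŷ) − ∇f₁(x₀), and Δ₁(u; y, v) := ψ(y) − ψ(u) − ⟨v, y − u⟩ + (1/2)‖u − y‖². If Δ₁(ŷ; y, v) ≤ ε and ‖v‖² + 2ε ≤ θ²‖y − x₀‖², then ‖v̂‖ ≤ [ L_{f₁}(y, x₀) + (2 + θ·C_λ(y,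 ŷ))/λ ] ‖y − x₀‖, where C_λ(x, y) := (1 + λ[M₂⁺ + L_{f₁}(x, y) + L_{f₂}(x, y)])/√(1 + λM₂⁺). -/

import Mathlib

open RealInnerProductSpace
open scoped Classical

theorem gradient_affine_add_prox {E : Type*} [NormedAddCommGroup E] [InnerProductSpace ℝ E]
    [CompleteSpace E] {f : E → ℝ} (lam c : ℝ) (p x₀ u : E) (hf : DifferentiableAt ℝ f u) :
    gradient (fun u => lam * (c + ⟪p, u - x₀⟫ + f u) + 1 / 2 * ‖u - x₀‖ ^ 2) u =
      lam • (p + gradient f u) + (u - x₀) := by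
  apply HasGradientAt.gradient
  rw [hasGradientAt_iff_hasFDerivAt]
  have hsub : HasFDerivAt (fun u : E => u - x₀) (ContinuousLinearMap.id ℝ E) u :=
    (hasFDerivAt_id u).sub_const x₀
  have hin := (innerSL ℝ p).hasFDerivAt.comp u hsub
  have hfu := hf.hasGradientAt.hasFDerivAt
  have key := (((hin.const_add c).add hfu).const_mul lam).add (hsub.norm_sq.const_mul (1 / 2))
  refine key.congr_fderiv ?_
  ext w
  simp

theorem nonneg_of_forall_add_mul_nonneg {X K : ℝ} (hK : 0 ≤ K)
    (hX : ∀ t : ℝ, 0 < t → t < 1 → 0 ≤ X + t * K) : 0 ≤ X := by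
  by_contra! hneg
  have hpos : 0 < 2 * (-X + K) := by linarith
  have ht : 0 < -X / (2 * (-X + K)) := div_pos (by linarith) hpos
  have ht1 : -X / (2 * (-X + K)) < 1 := by
    rw [div_lt_one hpos]; linarith
  have h1 := hX _ ht ht1
  have h2 : -X / (2 * (-X + K)) * (2 * (-X + K)) = -X := div_mul_cancel₀ _ hpos.ne'
  nlinarith

/-- Quadratic growth, in direction `y`, at a minimizer `z` of
`u ↦ ⟪q, u⟫ + M / 2 * ‖u - y‖ ^ 2 + lam * h u` with `h` convex. -/
theorem prox_quadratic_growth {E : Type*} [NormedAddCommGroup E] [InnerProductSpace ℝ E]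
    {h : E → EReal} {lam M a b : ℝ} {q y z : E} (hlam : 0 ≤ lam) (hM : 0 ≤ M)
    (hconvex : ∀ x y : E, ∀ t : ℝ, 0 ≤ t → t ≤ 1 →
      h (t • x + (1 - t) • y) ≤ ((t : ℝ) : EReal) * h x + ((1 - t : ℝ) : EReal) * h y)
    (ha : h y = (a : EReal)) (hb : h z = (b : EReal))
    (hz : ∀ u : E,
      ((⟪q, z⟫ + M / 2 * ‖z - y‖ ^ 2 : ℝ) : EReal) + ((lam : ℝ) : EReal) * h z ≤
        ((⟪q, u⟫ + M / 2 * ‖u - y‖ ^ 2 : ℝ) : EReal) + ((lam : ℝ) : EReal) * h u) :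
    ⟪q, z - y⟫ + M * ‖z - y‖ ^ 2 ≤ lam * (a - b) := by
  suffices 0 ≤ lam * (a - b) - ⟪q, z - y⟫ - M * ‖z - y‖ ^ 2 by linarith
  refine nonneg_of_forall_add_mul_nonneg (K := M / 2 * ‖z - y‖ ^ 2) (by positivity) ?_
  intro t ht ht1
  have hc := hconvex y z t ht.le ht1.le
  have hu := (hz (t • y + (1 - t) • z)).trans
    (add_le_add le_rfl (mul_le_mul_of_nonneg_left hc (EReal.coe_nonneg.mpr hlam)))
  rw [ha, hb] at hu
  norm_cast at hu
  have e1 : t • y + (1 - t) • z - y = (1 - t) • (z - y) := by module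
  have e2 : t • y + (1 - t) • z = z - t • (z - y) := by module
  have e3 : ‖(1 - t) • (z - y)‖ ^ 2 = (1 - t) ^ 2 * ‖z - y‖ ^ 2 := by
    rw [norm_smul, mul_pow, Real.norm_eq_abs, sq_abs]
  have e4 : ⟪q, t • y + (1 - t) • z⟫ = ⟪q, z⟫ - t * ⟪q, z - y⟫ := by
    rw [e2, inner_sub_right, inner_smul_right]
  rw [e1, e3, e4] at hu
  refine nonneg_of_mul_nonneg_right (a := t) ?_ ht
  nlinarith

theorem norm_sub_eq_local_lipschitz_mul {E F : Type*} [NormedAddCommGroup E]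
    [NormedAddCommGroup F] (g : E → F) (x y : E) :
    ‖g x - g y‖ = (if x = y then 0 else ‖g x - g y‖ / ‖x - y‖) * ‖x - y‖ := by
  split_ifs with hxy
  · simp [hxy]
  · rw [div_mul_cancel₀]
    exact norm_ne_zero_iff.mpr (sub_ne_zero.mpr hxy)


/-- the specialized refinement residual bound
`‖v̂‖ ≤ [L_{f₁}(y, x₀) + (2 + θ·C_λ(y, ŷ))/λ]‖y − x₀‖`. -/
theorem stmt_11 {E : Type*} [NormedAddCommGroup E] [InnerProductSpace ℝ E]
    [FiniteDimensional ℝ E]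
    (h : E → EReal) (f₁ f₂ : E → ℝ) (lam M₂p M θ ε : ℝ)
    -- h is proper closed convex
    (hproper : ∃ x, h x ≠ ⊤) (hnobot : ∀ x, h x ≠ ⊥)
    (hclosed : LowerSemicontinuous h)
    (hconvex : ∀ x y : E, ∀ t : ℝ, 0 ≤ t → t ≤ 1 →
      h (t • x + (1 - t) • y) ≤ ((t : ℝ) : EReal) * h x + ((1 - t : ℝ) : EReal) * h y)
    -- f₁, f₂ are continuously differentiable; curvature of f₂ on dom h
    (hf₁ : ContDiff ℝ 1 f₁) (hf₂ : ContDiff ℝ 1 f₂)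
    (hM₂p : 0 ≤ M₂p)
    (hcurv : ∀ u : E, h u ≠ ⊤ → ∀ w : E, h w ≠ ⊤ →
      f₂ u - f₂ w - ⟪gradient f₂ w, u - w⟫ ≤ M₂p / 2 * ‖u - w‖ ^ 2)
    (hlam : 0 < lam) (hθ : 0 < θ) (hθ1 : θ ≤ 1) (hε : 0 ≤ ε)
    (x₀ : E)
    -- y ∈ dom h
    (y : E) (hy : h y ≠ ⊤)
    (v : E)
    -- M := λM₂⁺ + 1
    (hM : M = lam * M₂p + 1)
    -- ψ_s(u) := λ[f₁(x₀) + ⟨∇f₁(x₀), u − x₀⟩ + f₂(u)] + (1/2)‖u − x₀‖²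
    (ψs : E → ℝ)
    (hψs : ∀ u : E, ψs u = lam * (f₁ x₀ + ⟪gradient f₁ x₀, u - x₀⟫ + f₂ u)
        + 1 / 2 * ‖u - x₀‖ ^ 2)
    -- ψ := ψ_s + λh
    (ψf : E → EReal)
    (hψf : ∀ u : E, ψf u = ((ψs u : ℝ) : EReal) + ((lam : ℝ) : EReal) * h u)
    -- ŷ := argmin_u { ⟨∇ψs(y) − v, u⟩ + (M/2)‖u − y‖² + λh(u) }
    (yhat : E)
    (hyhat : ∀ u : E,
      ((⟪gradient ψs y - v, yhat⟫ + M / 2 * ‖yhat - y‖ ^ 2 : ℝ) : EReal)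
          + ((lam : ℝ) : EReal) * h yhat ≤
        ((⟪gradient ψs y - v, u⟫ + M / 2 * ‖u - y‖ ^ 2 : ℝ) : EReal)
          + ((lam : ℝ) : EReal) * h u)
    -- v_r := v + M(y − ŷ) + ∇ψs(ŷ) − ∇ψs(y)
    (vr : E) (hvr : vr = v + M • (y - yhat) + gradient ψs yhat - gradient ψs y)
    -- v̂ := (1/λ)(v_r + x₀ − y) + ∇f₁(ŷ) − ∇f₁(x₀)
    (vhat : E)
    (hvhat : vhat = (1 / lam) • (vr + x₀ - y) + gradient f₁ yhat - gradient f₁ x₀)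
    -- local Lipschitz constants L_{f₁}, L_{f₂}
    (L₁ L₂ : E → E → ℝ)
    (hL₁ : ∀ x y : E, L₁ x y =
      if x = y then 0 else ‖gradient f₁ x - gradient f₁ y‖ / ‖x - y‖)
    (hL₂ : ∀ x y : E, L₂ x y =
      if x = y then 0 else ‖gradient f₂ x - gradient f₂ y‖ / ‖x - y‖)
    -- C_λ(x, y) := (1 + λ[M₂⁺ + L_{f₁}(x,y) + L_{f₂}(x,y)])/√(1 + λM₂⁺)
    (Cl : E → E → ℝ)
    (hCl : ∀ x y : E, Cl x y =
      (1 + lam * (M₂p + L₁ x y + L₂ x y)) / Real.sqrt (1 + lam * M₂p))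
    -- Δ₁(ŷ; y, v) ≤ ε
    (hΔ : ψf y - ψf yhat - ((⟪v, y - yhat⟫ : ℝ) : EReal)
        + ((1 / 2 * ‖yhat - y‖ ^ 2 : ℝ) : EReal) ≤ ((ε : ℝ) : EReal))
    -- ‖v‖² + 2ε ≤ θ²‖y − x₀‖²
    (hv : ‖v‖ ^ 2 + 2 * ε ≤ θ ^ 2 * ‖y - x₀‖ ^ 2) :
    ‖vhat‖ ≤ (L₁ y x₀ + (2 + θ * Cl y yhat) / lam) * ‖y - x₀‖ := by
  have hgrad : ∀ u, gradient ψs u = lam • (gradient f₁ x₀ + gradient f₂ u) + (u - x₀) := fun u => by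
    rw [funext hψs]
    exact gradient_affine_add_prox lam _ _ x₀ u (hf₂.differentiable one_ne_zero u)
  obtain ⟨a, ha⟩ : ∃ a : ℝ, h y = (a : EReal) := ⟨_, (EReal.coe_toReal hy (hnobot y)).symm⟩
  have hyhat_dom : h yhat ≠ ⊤ := by
    intro htop
    have hmin := hyhat y
    rw [htop, ha, EReal.coe_mul_top_of_pos hlam, EReal.coe_add_top, top_le_iff] at hmin
    norm_cast at hmin
    exact EReal.coe_ne_top _ hmin
  obtain ⟨b, hb⟩ : ∃ b : ℝ, h yhat = (b : EReal) :=
    ⟨_, (EReal.coe_toReal hyhat_dom (hnobot yhat)).symm⟩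
  have hMpos : 0 < M := by rw [hM]; positivity
  have hgrowth := prox_quadratic_growth hlam.le hMpos.le hconvex ha hb hyhat
  rw [hψf, hψf, hψs, hψs, ha, hb] at hΔ
  norm_cast at hΔ
  have hcv := mul_le_mul_of_nonneg_left (hcurv yhat hyhat_dom y hy) hlam.le
  have hd : M * ‖y - yhat‖ ^ 2 ≤ 2 * ε := by
    have e1 : ‖yhat - x₀‖ ^ 2 =
        ‖yhat - y‖ ^ 2 + 2 * ⟪y - x₀, yhat - y⟫ + ‖y - x₀‖ ^ 2 := by
      have : yhat - x₀ = (yhat - y) + (y - x₀) := by abel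
      rw [this, norm_add_sq_real, real_inner_comm]
    have e2 : ⟪gradient f₁ x₀, yhat - x₀⟫ =
        ⟪gradient f₁ x₀, yhat - y⟫ + ⟪gradient f₁ x₀, y - x₀⟫ := by
      rw [← inner_add_right]; congr 1; abel
    have e3 : ⟪v, y - yhat⟫ = -⟪v, yhat - y⟫ := by
      rw [← inner_neg_right, neg_sub]
    rw [hgrad, inner_sub_left, inner_add_left, real_inner_smul_left, inner_add_left] at hgrowth
    rw [e1, e2, e3] at hΔ
    rw [norm_sub_rev y yhat]
    subst hM
    nlinarith [sq_nonneg ‖yhat - y‖]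
  set r := ‖y - x₀‖ with hr
  have hr0 : 0 ≤ r := norm_nonneg _
  have hvr' : ‖v‖ ≤ r := by
    refine (abs_le_of_sq_le_sq' (a := ‖v‖) (b := θ * r) (by nlinarith) (by positivity)).2.trans ?_
    exact mul_le_of_le_one_left hr0 hθ1
  have hdist : ‖y - yhat‖ ≤ θ * r / Real.sqrt M := by
    rw [le_div_iff₀ (Real.sqrt_pos.mpr hMpos)]
    refine (abs_le_of_sq_le_sq' ?_ (by positivity)).2
    rw [mul_pow, Real.sq_sqrt hMpos.le]
    nlinarith [sq_nonneg ‖v‖]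
  have h₁ : ∀ x y, ‖gradient f₁ x - gradient f₁ y‖ = L₁ x y * ‖x - y‖ := fun x y => by
    rw [hL₁, ← norm_sub_eq_local_lipschitz_mul]
  have h₂ : ∀ x y, ‖gradient f₂ x - gradient f₂ y‖ = L₂ x y * ‖x - y‖ := fun x y => by
    rw [hL₂, ← norm_sub_eq_local_lipschitz_mul]
  have hL₁0 : 0 ≤ L₁ y yhat := by rw [hL₁]; split_ifs <;> positivity
  have hL₂0 : 0 ≤ L₂ y yhat := by rw [hL₂]; split_ifs <;> positivity
  have hrep : vhat = (1 / lam) • (v - (y - x₀)) + M₂p • (y - yhat)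
      - (gradient f₂ y - gradient f₂ yhat) - (gradient f₁ y - gradient f₁ yhat)
      + (gradient f₁ y - gradient f₁ x₀) := by
    rw [hvhat, hvr, hgrad, hgrad, hM]
    match_scalars <;> field_simp <;> ring
  have hbound : ‖vhat‖ ≤ (1 / lam) * (‖v‖ + r) + M₂p * ‖y - yhat‖ + L₂ y yhat * ‖y - yhat‖
      + L₁ y yhat * ‖y - yhat‖ + L₁ y x₀ * r := by
    rw [hrep, ← h₁, ← h₂, hr, ← h₁]
    refine (norm_add_le _ _).trans (add_le_add ?_ le_rfl)
    refine (norm_sub_le _ _).trans (add_le_add ?_ le_rfl)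
    refine (norm_sub_le _ _).trans (add_le_add ?_ le_rfl)
    refine (norm_add_le _ _).trans (add_le_add ?_ ?_)
    · rw [norm_smul, Real.norm_of_nonneg (by positivity)]
      gcongr
      exact norm_sub_le _ _
    · rw [norm_smul, Real.norm_of_nonneg hM₂p]
  have hC : lam * (M₂p + L₁ y yhat + L₂ y yhat) * ‖y - yhat‖ ≤ θ * Cl y yhat * r := by
    have hM' : 1 + lam * M₂p = M := by rw [hM]; ring
    calc lam * (M₂p + L₁ y yhat + L₂ y yhat) * ‖y - yhat‖
        ≤ (1 + lam * (M₂p + L₁ y yhat + L₂ y yhat)) * (θ * r / Real.sqrt M) := by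
          gcongr
          linarith
      _ = θ * Cl y yhat * r := by rw [hCl, hM']; ring
  calc ‖vhat‖ ≤ L₁ y x₀ * r + (‖v‖ + r
        + lam * (M₂p + L₁ y yhat + L₂ y yhat) * ‖y - yhat‖) / lam := by
        refine hbound.trans (le_of_eq ?_)
        field_simp
        ring
    _ ≤ L₁ y x₀ * r + (r + r + θ * Cl y yhat * r) / lam := by gcongr
    _ = (L₁ y x₀ + (2 + θ * Cl y yhat) / lam) * r := by ring
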